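/- Let n ≥ 1, let g : ℝⁿ → (symmetric positive-definite n×n real matrices) be smooth, let ψ : ℝⁿ → ℝ be smooth and positive, and let γ : ℝ × [0,t₀) → ℝ^{1+n} be a curve shortening flow in local coordinates with respect to the left warped product metric G_L. If at a point (x,t) the angle function Θ_L = ⟨T, ∂r⟩_{G_L} satisfies Θ_L ≥ 0, then at that point ∂_t Θ_L ≥ ΔΘ_L − |D(log ψ)|² Θ_L − 2 T(Θ_L) ⟨T, D(log ψ)⟩_{G_L}, where |D(log ψ)|² = Σ_{k,l} (g⁻¹)^{kl} ∂_k(log ψ) ∂_l(log ψ) and D(log ψ), |D(log ψ)|² are evaluated at the ℝⁿ-component of γ(x,t). -/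

import Mathlib

open scoped BigOperators

noncomputable section

/-- Inner product of two vectors with respect to a metric matrix `G`. -/
def minner {m : ℕ} (G : Matrix (Fin m) (Fin m) ℝ) (u v : Fin m → ℝ) : ℝ :=
  ∑ α, ∑ β, u α * G α β * v β

/-- Norm of a vector with respect to a metric matrix `G`. -/
def mnorm {m : ℕ} (G : Matrix (Fin m) (Fin m) ℝ) (v : Fin m → ℝ) : ℝ :=
  Real.sqrt (minner G v v)

/-- Christoffel symbols `Γ^α_{βγ}` of the metric `G` at the point `p`:
`Γ^α_{βγ} = (1/2) Σ_δ (G⁻¹)^{αδ}(∂_β G_{δγ} + ∂_γ G_{δβ} − ∂_δ G_{βγ})`. -/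
def christoffel {m : ℕ} (G : (Fin m → ℝ) → Matrix (Fin m) (Fin m) ℝ)
    (p : Fin m → ℝ) (α β γ : Fin m) : ℝ :=
  (1 / 2) * ∑ δ, (G p)⁻¹ α δ *
      (fderiv ℝ (fun q => G q δ γ) p (Pi.single β 1)
        + fderiv ℝ (fun q => G q δ β) p (Pi.single γ 1)
        - fderiv ℝ (fun q => G q β γ) p (Pi.single δ 1))

/-- Unit tangent vector `T = ∂ₓc/|∂ₓc|_G` of a curve `c` with respect to the metric `G`. -/
def unitT {m : ℕ} (G : (Fin m → ℝ) → Matrix (Fin m) (Fin m) ℝ)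
    (c : ℝ → Fin m → ℝ) (x : ℝ) : Fin m → ℝ :=
  (mnorm (G (c x)) (deriv c x))⁻¹ • deriv c x

/-- Covariant derivative `∇_T V` of a vector field `V` along the curve `c`. -/
def covT {m : ℕ} (G : (Fin m → ℝ) → Matrix (Fin m) (Fin m) ℝ)
    (c V : ℝ → Fin m → ℝ) (x : ℝ) : Fin m → ℝ :=
  fun α => (mnorm (G (c x)) (deriv c x))⁻¹ *
    (deriv (fun y => V y α) x
      + ∑ β, ∑ δ, christoffel G (c x) α β δ * deriv c x β * V x δ)

/-- Mean curvature vector `H = ∇_T T` of the curve `c`. -/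
def meanCurv {m : ℕ} (G : (Fin m → ℝ) → Matrix (Fin m) (Fin m) ℝ)
    (c : ℝ → Fin m → ℝ) : ℝ → Fin m → ℝ :=
  covT G c (unitT G c)

/-- Directional derivative `T(η) = |∂ₓc|⁻¹ ∂ₓη` of a scalar function along the curve `c`. -/
def Tscal {m : ℕ} (G : (Fin m → ℝ) → Matrix (Fin m) (Fin m) ℝ)
    (c : ℝ → Fin m → ℝ) (η : ℝ → ℝ) (x : ℝ) : ℝ :=
  (mnorm (G (c x)) (deriv c x))⁻¹ * deriv η x

/-- Laplacian `Δη = T(T(η))` along the curve `c`. -/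
def lapScal {m : ℕ} (G : (Fin m → ℝ) → Matrix (Fin m) (Fin m) ℝ)
    (c : ℝ → Fin m → ℝ) (η : ℝ → ℝ) : ℝ → ℝ :=
  Tscal G c (Tscal G c η)

/-- Time covariant derivative `∇_t V` along a flow `γ`. -/
def covTime {m : ℕ} (G : (Fin m → ℝ) → Matrix (Fin m) (Fin m) ℝ)
    (γ V : ℝ → ℝ → Fin m → ℝ) (x t : ℝ) : Fin m → ℝ :=
  fun α => deriv (fun s => V x s α) t
    + ∑ β, ∑ δ, christoffel G (γ x t) α β δ * deriv (fun s => γ x s β) t * V x t δ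

/-- Left warped product metric `g + ψ²(x) dr²` on `ℝ^{1+n}` (index 0 is the circle direction). -/
def gwL {n : ℕ} (g : (Fin n → ℝ) → Matrix (Fin n) (Fin n) ℝ)
    (ψ : (Fin n → ℝ) → ℝ) (p : Fin (n + 1) → ℝ) : Matrix (Fin (n + 1)) (Fin (n + 1)) ℝ :=
  Matrix.of fun α β =>
    Fin.cases (Fin.cases ((ψ fun i => p i.succ) ^ 2) (fun _ => 0) β)
      (fun i => Fin.cases 0 (fun j => g (fun k => p k.succ) i j) β) α

/-- Right warped product metric `φ²(r) g + dr²` on `ℝ^{1+n}` (index 0 is the circle direction). -/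
def gwR {n : ℕ} (g : (Fin n → ℝ) → Matrix (Fin n) (Fin n) ℝ)
    (φ : ℝ → ℝ) (p : Fin (n + 1) → ℝ) : Matrix (Fin (n + 1)) (Fin (n + 1)) ℝ :=
  Matrix.of fun α β =>
    Fin.cases (Fin.cases 1 (fun _ => 0) β)
      (fun i => Fin.cases 0 (fun j => (φ (p 0)) ^ 2 * g (fun k => p k.succ) i j) β) α

/-- The vector `∂r = e₀` in `ℝ^{1+n}`. -/
def er (n : ℕ) : Fin (n + 1) → ℝ := Pi.single 0 1

/-- The gradient `D(log ψ)` of `log ψ` with respect to `(N, g)`, as a vector in `ℝ^{1+n}`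
with vanishing 0-th component. -/
def DlogPsi {n : ℕ} (g : (Fin n → ℝ) → Matrix (Fin n) (Fin n) ℝ)
    (ψ : (Fin n → ℝ) → ℝ) (x : Fin n → ℝ) : Fin (n + 1) → ℝ :=
  Fin.cases 0 (fun i => ∑ k, (g x)⁻¹ i k *
    fderiv ℝ (fun y => Real.log (ψ y)) x (Pi.single k 1))

/-- `|D(log ψ)|² = Σ_{k,l} (g⁻¹)^{kl} ∂_k(log ψ) ∂_l(log ψ)`. -/
def normSqDlogPsi {n : ℕ} (g : (Fin n → ℝ) → Matrix (Fin n) (Fin n) ℝ)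
    (ψ : (Fin n → ℝ) → ℝ) (x : Fin n → ℝ) : ℝ :=
  ∑ k, ∑ l, (g x)⁻¹ k l *
    fderiv ℝ (fun y => Real.log (ψ y)) x (Pi.single k 1) *
    fderiv ℝ (fun y => Real.log (ψ y)) x (Pi.single l 1)

/-- `∇_X ∂r` at the point `p`, i.e. `(∇_X ∂r)^α = Σ_β X^β Γ^α_{β0}`. -/
def covR {m : ℕ} [NeZero m] (G : (Fin m → ℝ) → Matrix (Fin m) (Fin m) ℝ)
    (p : Fin m → ℝ) (X : Fin m → ℝ) : Fin m → ℝ :=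
  fun α => ∑ β, X β * christoffel G p α β 0

/-- The angle function `Θ_L = ⟨T, ∂r⟩_{G_L}` of a flow `γ` in the left warped product. -/
def thetaL {n : ℕ} (g : (Fin n → ℝ) → Matrix (Fin n) (Fin n) ℝ)
    (ψ : (Fin n → ℝ) → ℝ) (γ : ℝ → ℝ → Fin (n + 1) → ℝ) (x t : ℝ) : ℝ :=
  minner (gwL g ψ (γ x t)) (unitT (gwL g ψ) (fun y => γ y t) x) (er n)

/-- The angle function `Θ_R = ⟨T, ∂r⟩_{G_R}` of a flow `γ` in the right warped product. -/
def thetaR {n : ℕ} (g : (Fin n → ℝ) → Matrix (Fin n) (Fin n) ℝ)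
    (φ : ℝ → ℝ) (γ : ℝ → ℝ → Fin (n + 1) → ℝ) (x t : ℝ) : ℝ :=
  minner (gwR g φ (γ x t)) (unitT (gwR g φ) (fun y => γ y t) x) (er n)

section BilinearForm

variable {m : ℕ}

lemma minner_eq_dotProduct (A : Matrix (Fin m) (Fin m) ℝ) (u v : Fin m → ℝ) :
    minner A u v = u ⬝ᵥ A.mulVec v := by
  simp [minner, dotProduct, Matrix.mulVec, Finset.mul_sum, mul_assoc]

lemma minner_add_left (A : Matrix (Fin m) (Fin m) ℝ) (u v w : Fin m → ℝ) :
    minner A (u + v) w = minner A u w + minner A v w := by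
  simp [minner_eq_dotProduct, add_dotProduct]

lemma minner_add_right (A : Matrix (Fin m) (Fin m) ℝ) (u v w : Fin m → ℝ) :
    minner A u (v + w) = minner A u v + minner A u w := by
  simp [minner_eq_dotProduct, Matrix.mulVec_add, dotProduct_add]

lemma minner_smul_left (A : Matrix (Fin m) (Fin m) ℝ) (k : ℝ) (u v : Fin m → ℝ) :
    minner A (k • u) v = k * minner A u v := by
  simp [minner_eq_dotProduct]

lemma minner_smul_right (A : Matrix (Fin m) (Fin m) ℝ) (k : ℝ) (u v : Fin m → ℝ) :
    minner A u (k • v) = k * minner A u v := by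
  simp [minner_eq_dotProduct, Matrix.mulVec_smul]

lemma minner_comm {A : Matrix (Fin m) (Fin m) ℝ} (hA : ∀ a b, A a b = A b a)
    (u v : Fin m → ℝ) : minner A u v = minner A v u := by
  unfold minner
  rw [Finset.sum_comm]
  refine Finset.sum_congr rfl fun a _ => Finset.sum_congr rfl fun b _ => ?_
  rw [hA b a]; ring

lemma minner_smul_matrix (A : Matrix (Fin m) (Fin m) ℝ) (k : ℝ) (u v : Fin m → ℝ) :
    minner (k • A) u v = k * minner A u v := by
  simp [minner_eq_dotProduct, Matrix.smul_mulVec]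

lemma minner_pos {A : Matrix (Fin m) (Fin m) ℝ} (hA : A.PosDef) {v : Fin m → ℝ} (hv : v ≠ 0) :
    0 < minner A v v := by
  simpa [minner_eq_dotProduct] using hA.dotProduct_mulVec_pos hv

lemma minner_self_nonneg {A : Matrix (Fin m) (Fin m) ℝ} (hA : A.PosDef) (v : Fin m → ℝ) :
    0 ≤ minner A v v := by
  by_cases hv : v = 0
  · simp [hv, minner]
  · exact (minner_pos hA hv).le

lemma mnorm_pos {A : Matrix (Fin m) (Fin m) ℝ} (hA : A.PosDef) {v : Fin m → ℝ} (hv : v ≠ 0) :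
    0 < mnorm A v := Real.sqrt_pos.2 (minner_pos hA hv)

lemma mnorm_sq {A : Matrix (Fin m) (Fin m) ℝ} (hA : A.PosDef) (v : Fin m → ℝ) :
    mnorm A v ^ 2 = minner A v v := Real.sq_sqrt (minner_self_nonneg hA v)

lemma hasDerivAt_minner {A : ℝ → Matrix (Fin m) (Fin m) ℝ} {V W : ℝ → Fin m → ℝ}
    {A' : Matrix (Fin m) (Fin m) ℝ} {V' W' : Fin m → ℝ} {x : ℝ}
    (hA : ∀ a b, HasDerivAt (fun y => A y a b) (A' a b) x)
    (hV : HasDerivAt V V' x) (hW : HasDerivAt W W' x) :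
    HasDerivAt (fun y => minner (A y) (V y) (W y))
      (minner (A x) V' (W x) + minner A' (V x) (W x) + minner (A x) (V x) W') x := by
  rw [hasDerivAt_pi] at hV hW
  unfold minner
  simp only [← Finset.sum_add_distrib]
  refine HasDerivAt.fun_sum fun a _ => HasDerivAt.fun_sum fun b _ => ?_
  refine (((hV a).mul (hA a b)).mul (hW b)).congr_deriv ?_
  simp only [Pi.mul_apply]
  ring

end BilinearForm

section Metric

variable {m : ℕ} {G : (Fin m → ℝ) → Matrix (Fin m) (Fin m) ℝ}

/-- Entrywise directional derivative at `p` of a matrix field `G` in the direction `V`. -/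
def metricDeriv (G : (Fin m → ℝ) → Matrix (Fin m) (Fin m) ℝ) (p V : Fin m → ℝ) :
    Matrix (Fin m) (Fin m) ℝ :=
  Matrix.of fun a b => fderiv ℝ (fun q => G q a b) p V

lemma metricDeriv_smul (p V : Fin m → ℝ) (k : ℝ) :
    metricDeriv G p (k • V) = k • metricDeriv G p V := by
  ext a b
  simp [metricDeriv]

lemma metricDeriv_comm (hs : ∀ p a b, G p a b = G p b a) (p V : Fin m → ℝ) (a b : Fin m) :
    metricDeriv G p V a b = metricDeriv G p V b a := by
  simp [metricDeriv, hs _ a b]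

lemma metricDeriv_eq_sum (p V : Fin m → ℝ) (a b : Fin m) :
    metricDeriv G p V a b = ∑ d, V d * fderiv ℝ (fun q => G q a b) p (Pi.single d 1) := by
  conv_lhs => rw [metricDeriv, Matrix.of_apply, pi_eq_sum_univ' V]
  simp [Pi.single]

lemma hasDerivAt_metric_comp (hG : ∀ a b, Differentiable ℝ fun p => G p a b)
    {c : ℝ → Fin m → ℝ} {c' : Fin m → ℝ} {x : ℝ} (hc : HasDerivAt c c' x) (a b : Fin m) :
    HasDerivAt (fun y => G (c y) a b) (metricDeriv G (c x) c' a b) x :=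
  ((hG a b) (c x)).hasFDerivAt.comp_hasDerivAt x hc

lemma sum_metric_mul_christoffel {p : Fin m → ℝ} (hp : IsUnit (G p).det) (a β δ : Fin m) :
    ∑ b, G p a b * christoffel G p b β δ =
      (1 / 2) * (fderiv ℝ (fun q => G q a δ) p (Pi.single β 1)
        + fderiv ℝ (fun q => G q a β) p (Pi.single δ 1)
        - fderiv ℝ (fun q => G q β δ) p (Pi.single a 1)) := by
  have key (f : Fin m → ℝ) : ∑ b, G p a b * ((1 / 2) * ∑ e, (G p)⁻¹ b e * f e) =
      (1 / 2) * f a := by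
    have h : (G p).mulVec ((G p)⁻¹.mulVec f) = f := by
      rw [Matrix.mulVec_mulVec, Matrix.mul_nonsing_inv _ hp, Matrix.one_mulVec]
    have h' := congrFun h a
    simp only [Matrix.mulVec, dotProduct] at h'
    rw [← h', Finset.mul_sum]
    exact Finset.sum_congr rfl fun b _ => by ring
  exact key fun e => fderiv ℝ (fun q => G q e δ) p (Pi.single β 1)
        + fderiv ℝ (fun q => G q e β) p (Pi.single δ 1)
        - fderiv ℝ (fun q => G q β δ) p (Pi.single e 1)

lemma minner_christoffel {p : Fin m → ℝ} (hp : IsUnit (G p).det) (Z u w : Fin m → ℝ) :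
    minner (G p) Z (fun α => ∑ β, ∑ δ, christoffel G p α β δ * u β * w δ) =
      (1 / 2) * (minner (metricDeriv G p u) Z w + minner (metricDeriv G p w) Z u
        - minner (metricDeriv G p Z) u w) := by
  have h1 : minner (G p) Z (fun α => ∑ β, ∑ δ, christoffel G p α β δ * u β * w δ) =
      ∑ a, ∑ β, ∑ δ, Z a * u β * w δ * ∑ b, G p a b * christoffel G p b β δ := by
    unfold minner
    refine Finset.sum_congr rfl fun a _ => ?_
    simp only [Finset.mul_sum]
    rw [Finset.sum_comm]
    refine Finset.sum_congr rfl fun β _ => ?_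
    rw [Finset.sum_comm]
    exact Finset.sum_congr rfl fun δ _ => Finset.sum_congr rfl fun b _ => by ring
  have h2 : minner (metricDeriv G p u) Z w = ∑ a, ∑ β, ∑ δ, Z a * u β * w δ *
      fderiv ℝ (fun q => G q a δ) p (Pi.single β 1) := by
    unfold minner
    refine Finset.sum_congr rfl fun a _ => ?_
    rw [Finset.sum_comm]
    refine Finset.sum_congr rfl fun δ _ => ?_
    rw [metricDeriv_eq_sum, Finset.mul_sum, Finset.sum_mul]
    exact Finset.sum_congr rfl fun b _ => by ring
  have h3 : minner (metricDeriv G p w) Z u = ∑ a, ∑ β, ∑ δ, Z a * u β * w δ *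
      fderiv ℝ (fun q => G q a β) p (Pi.single δ 1) := by
    unfold minner
    refine Finset.sum_congr rfl fun a _ => Finset.sum_congr rfl fun β _ => ?_
    rw [metricDeriv_eq_sum, Finset.mul_sum, Finset.sum_mul]
    exact Finset.sum_congr rfl fun b _ => by ring
  have h4 : minner (metricDeriv G p Z) u w = ∑ a, ∑ β, ∑ δ, Z a * u β * w δ *
      fderiv ℝ (fun q => G q β δ) p (Pi.single a 1) := by
    unfold minner
    symm
    rw [Finset.sum_comm]
    refine Finset.sum_congr rfl fun β _ => ?_
    rw [Finset.sum_comm]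
    refine Finset.sum_congr rfl fun δ _ => ?_
    rw [metricDeriv_eq_sum, Finset.mul_sum, Finset.sum_mul]
    exact Finset.sum_congr rfl fun a _ => by ring
  rw [h1, h2, h3, h4]
  simp only [sum_metric_mul_christoffel hp, Finset.mul_sum, ← Finset.sum_add_distrib,
    ← Finset.sum_sub_distrib]
  exact Finset.sum_congr rfl fun a _ => Finset.sum_congr rfl fun β _ =>
    Finset.sum_congr rfl fun δ _ => by ring

/-- The curvature vector of a curve in lowered form, tested against a vector `Z`. -/
lemma mnorm_mul_minner_meanCurv (hpd : ∀ p, (G p).PosDef) {c : ℝ → Fin m → ℝ} {x : ℝ}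
    (hreg : deriv c x ≠ 0) (hT : DifferentiableAt ℝ (unitT G c) x) (Z : Fin m → ℝ) :
    mnorm (G (c x)) (deriv c x) * minner (G (c x)) Z (meanCurv G c x) =
      minner (metricDeriv G (c x) (deriv c x)) Z (unitT G c x)
        + minner (G (c x)) Z (deriv (unitT G c) x)
        - (mnorm (G (c x)) (deriv c x) / 2) *
          minner (metricDeriv G (c x) Z) (unitT G c x) (unitT G c x) := by
  have hv : mnorm (G (c x)) (deriv c x) ≠ 0 := (mnorm_pos (hpd _) hreg).ne'
  have hT' : ∀ α, deriv (fun y => unitT G c y α) x = deriv (unitT G c) x α := fun α =>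
    (hasDerivAt_pi.1 hT.hasDerivAt α).deriv
  have hc : deriv c x = mnorm (G (c x)) (deriv c x) • unitT G c x := by
    rw [unitT, smul_smul, mul_inv_cancel₀ hv, one_smul]
  have hH : meanCurv G c x = (mnorm (G (c x)) (deriv c x))⁻¹ • (deriv (unitT G c) x +
      fun α => ∑ β, ∑ δ, christoffel G (c x) α β δ * deriv c x β * unitT G c x δ) := by
    ext α
    simp [meanCurv, covT, hT']
  rw [hH, minner_smul_right, minner_add_right,
    minner_christoffel ((Matrix.isUnit_iff_isUnit_det _).1 (hpd _).isUnit), mul_inv_cancel_left₀ hv]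
  generalize mnorm (G (c x)) (deriv c x) = v at hc
  rw [hc]
  simp only [metricDeriv_smul, minner_smul_left, minner_smul_right, minner_smul_matrix]
  ring

end Metric

section Flow

lemma hasDerivAt_slice_fst {E : Type*} [NormedAddCommGroup E] [NormedSpace ℝ E]
    {f : ℝ × ℝ → E} (hf : Differentiable ℝ f) (y s : ℝ) :
    HasDerivAt (fun z => f (z, s)) (fderiv ℝ f (y, s) (1, 0)) y :=
  HasFDerivAt.comp_hasDerivAt (l := f) (f := fun z : ℝ => (z, s)) y (hf (y, s)).hasFDerivAt
    ((hasDerivAt_id y).prodMk (hasDerivAt_const y s))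

lemma hasDerivAt_slice_snd {E : Type*} [NormedAddCommGroup E] [NormedSpace ℝ E]
    {f : ℝ × ℝ → E} (hf : Differentiable ℝ f) (y s : ℝ) :
    HasDerivAt (fun z => f (y, z)) (fderiv ℝ f (y, s) (0, 1)) s :=
  HasFDerivAt.comp_hasDerivAt (l := f) (f := fun z : ℝ => (y, z)) s (hf (y, s)).hasFDerivAt
    ((hasDerivAt_const s y).prodMk (hasDerivAt_id s))

lemma hasDerivAt_deriv_swap {E : Type*} [NormedAddCommGroup E] [NormedSpace ℝ E]
    {F : ℝ → ℝ → E} (hF : ContDiff ℝ (⊤ : ℕ∞) fun q : ℝ × ℝ => F q.1 q.2) (x t : ℝ) :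
    HasDerivAt (fun s => deriv (fun y => F y s) x) (deriv (fun y => deriv (F y) t) x) t := by
  set f : ℝ × ℝ → E := fun q => F q.1 q.2
  have hd : Differentiable ℝ f := hF.differentiable (by simp)
  have hd' : Differentiable ℝ (fderiv ℝ f) :=
    (hF.fderiv_right (m := 1) (by norm_cast)).differentiable (by simp)
  have e1 (y s : ℝ) : deriv (fun z => F z s) y = fderiv ℝ f (y, s) (1, 0) :=
    (hasDerivAt_slice_fst hd y s).deriv
  have e2 (y s : ℝ) : deriv (F y) s = fderiv ℝ f (y, s) (0, 1) :=
    (hasDerivAt_slice_snd hd y s).deriv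
  have h1 := (hasDerivAt_slice_snd hd' x t).clm_apply (hasDerivAt_const t ((1 : ℝ), (0 : ℝ)))
  have h2 := (hasDerivAt_slice_fst hd' x t).clm_apply (hasDerivAt_const x ((0 : ℝ), (1 : ℝ)))
  have hsymm : IsSymmSndFDerivAt ℝ f (x, t) :=
    hF.contDiffAt.isSymmSndFDerivAt (by
      simpa using WithTop.coe_le_coe.2 (le_top : (2 : ℕ∞) ≤ ⊤))
  simp only [e1, e2]
  rw [h2.deriv, hsymm (1, 0) (0, 1), map_zero, ← map_zero (fderiv ℝ f (x, t))]
  exact h1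

variable {m : ℕ} {G : (Fin m → ℝ) → Matrix (Fin m) (Fin m) ℝ}

lemma contDiff_slice {γ : ℝ → ℝ → Fin m → ℝ}
    (hγ : ContDiff ℝ (⊤ : ℕ∞) fun q : ℝ × ℝ => γ q.1 q.2) (t : ℝ) :
    ContDiff ℝ (⊤ : ℕ∞) fun y => γ y t :=
  hγ.comp (contDiff_id.prodMk contDiff_const)

lemma differentiable_timeDeriv {γ : ℝ → ℝ → Fin m → ℝ}
    (hγ : ContDiff ℝ (⊤ : ℕ∞) fun q : ℝ × ℝ => γ q.1 q.2) (t : ℝ) :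
    Differentiable ℝ fun y => deriv (γ y) t := by
  have hd : Differentiable ℝ fun q : ℝ × ℝ => γ q.1 q.2 := hγ.differentiable (by simp)
  have hd' : Differentiable ℝ (fderiv ℝ fun q : ℝ × ℝ => γ q.1 q.2) :=
    (hγ.fderiv_right (m := 1) (by norm_cast)).differentiable (by simp)
  have e (y : ℝ) : deriv (γ y) t = fderiv ℝ (fun q : ℝ × ℝ => γ q.1 q.2) (y, t) (0, 1) :=
    (hasDerivAt_slice_snd hd y t).deriv
  simp only [e]
  exact (hd'.comp (differentiable_id.prodMk (differentiable_const t))).clm_apply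
    (differentiable_const _)

lemma differentiable_unitT (hG : ∀ a b, Differentiable ℝ fun p => G p a b)
    (hpd : ∀ p, (G p).PosDef) {c : ℝ → Fin m → ℝ} (hc : ContDiff ℝ (⊤ : ℕ∞) c)
    (hreg : ∀ y, deriv c y ≠ 0) : Differentiable ℝ (unitT G c) := by
  intro y
  have hd : DifferentiableAt ℝ c y := hc.differentiable (by simp) y
  have hdd : DifferentiableAt ℝ (deriv c) y :=
    (contDiff_infty_iff_deriv.1 hc).2.differentiable (by simp) y
  have hN : DifferentiableAt ℝ (fun y => minner (G (c y)) (deriv c y) (deriv c y)) y :=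
    (hasDerivAt_minner (hasDerivAt_metric_comp hG hd.hasDerivAt) hdd.hasDerivAt
      hdd.hasDerivAt).differentiableAt
  have hv : DifferentiableAt ℝ (fun y => mnorm (G (c y)) (deriv c y)) y :=
    hN.sqrt (minner_pos (hpd _) (hreg y)).ne'
  exact (hv.inv (mnorm_pos (hpd _) (hreg y)).ne').smul hdd

lemma deriv_eq_mnorm_smul_unitT (hpd : ∀ p, (G p).PosDef) {c : ℝ → Fin m → ℝ} {x : ℝ}
    (hreg : deriv c x ≠ 0) :
    deriv c x = mnorm (G (c x)) (deriv c x) • unitT G c x := by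
  rw [unitT, smul_smul, mul_inv_cancel₀ (mnorm_pos (hpd _) hreg).ne', one_smul]

lemma minner_unitT_self (hpd : ∀ p, (G p).PosDef) {c : ℝ → Fin m → ℝ} {x : ℝ}
    (hreg : deriv c x ≠ 0) : minner (G (c x)) (unitT G c x) (unitT G c x) = 1 := by
  have hv := (mnorm_pos (hpd (c x)) hreg).ne'
  rw [unitT, minner_smul_left, minner_smul_right, ← mnorm_sq (hpd _)]
  field_simp

lemma symm_of_posDef {A : Matrix (Fin m) (Fin m) ℝ} (hA : A.PosDef) (a b : Fin m) :
    A a b = A b a := by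
  simpa using (hA.isHermitian.apply a b).symm

lemma minner_unitT_meanCurv (hG : ∀ a b, Differentiable ℝ fun p => G p a b)
    (hpd : ∀ p, (G p).PosDef) {c : ℝ → Fin m → ℝ} (hc : ContDiff ℝ (⊤ : ℕ∞) c)
    (hreg : ∀ y, deriv c y ≠ 0) (x : ℝ) :
    minner (G (c x)) (unitT G c x) (meanCurv G c x) = 0 := by
  have hT := differentiable_unitT hG hpd hc hreg x
  have hv := mnorm_pos (hpd (c x)) (hreg x)
  have h := mnorm_mul_minner_meanCurv hpd (hreg x) hT (unitT G c x)
  have h1 := hasDerivAt_minner (hasDerivAt_metric_comp hG (hc.differentiable (by simp) x).hasDerivAt)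
    hT.hasDerivAt hT.hasDerivAt
  have h2 : (fun y => minner (G (c y)) (unitT G c y) (unitT G c y)) = fun _ => 1 :=
    funext fun y => minner_unitT_self hpd (hreg y)
  rw [h2] at h1
  have h3 := h1.unique (hasDerivAt_const x (1 : ℝ))
  rw [minner_comm (symm_of_posDef (hpd _)) (deriv (unitT G c) x)] at h3
  have hD : minner (metricDeriv G (c x) (deriv c x)) (unitT G c x) (unitT G c x) =
      mnorm (G (c x)) (deriv c x) *
        minner (metricDeriv G (c x) (unitT G c x)) (unitT G c x) (unitT G c x) := by
    conv_lhs => rw [deriv_eq_mnorm_smul_unitT hpd (hreg x), metricDeriv_smul, minner_smul_matrix]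
  rw [hD] at h h3
  refine (mul_eq_zero.1 (h.trans ?_)).resolve_left hv.ne'
  linarith

/-- Along a curve shortening flow the length element satisfies `∂ₜ|∂ₓγ| = -|H|²|∂ₓγ|`. -/
lemma hasDerivAt_mnorm_flow (hG : ∀ a b, Differentiable ℝ fun p => G p a b)
    (hpd : ∀ p, (G p).PosDef) {γ : ℝ → ℝ → Fin m → ℝ}
    (hγ : ContDiff ℝ (⊤ : ℕ∞) fun q : ℝ × ℝ => γ q.1 q.2) {t : ℝ}
    (hreg : ∀ x, deriv (fun y => γ y t) x ≠ 0)
    (hflow : ∀ x, deriv (γ x) t = meanCurv G (fun y => γ y t) x) (x : ℝ) :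
    HasDerivAt (fun s => mnorm (G (γ x s)) (deriv (fun y => γ y s) x))
      (-(mnorm (G (γ x t)) (deriv (fun y => γ y t) x) *
        minner (G (γ x t)) (deriv (γ x) t) (deriv (γ x) t))) t := by
  have hc := contDiff_slice hγ t
  have hcx : HasDerivAt (fun y => γ y t) (deriv (fun y => γ y t) x) x :=
    (hc.differentiable (by simp) x).hasDerivAt
  have hγt : HasDerivAt (γ x) (deriv (γ x) t) t :=
    ((hγ.comp (contDiff_const.prodMk contDiff_id) :
      ContDiff ℝ (⊤ : ℕ∞) fun s => γ x s).differentiable (by simp) t).hasDerivAt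
  have hT := differentiable_unitT hG hpd hc hreg x
  have hH := (differentiable_timeDeriv hγ t x).hasDerivAt
  have hv := mnorm_pos (hpd (γ x t)) (hreg x)
  have hw := hasDerivAt_deriv_swap hγ x t
  have hN := hasDerivAt_minner (hasDerivAt_metric_comp hG hγt) hw hw
  have h0 := hasDerivAt_minner (hasDerivAt_metric_comp hG hcx) hT.hasDerivAt hH
  have h0' : (fun y => minner (G (γ y t)) (unitT G (fun y => γ y t) y) (deriv (γ y) t)) =
      fun _ => 0 := funext fun y => by
    rw [hflow]
    exact minner_unitT_meanCurv hG hpd hc hreg y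
  rw [h0'] at h0
  have h1 := h0.unique (hasDerivAt_const x (0 : ℝ))
  have h2 := mnorm_mul_minner_meanCurv hpd (hreg x) hT (deriv (γ x) t)
  have hsym := symm_of_posDef (hpd (γ x t))
  have hsym' := metricDeriv_comm (fun p => symm_of_posDef (hpd p)) (γ x t)
    (deriv (fun y => γ y t) x)
  refine (hN.sqrt (minner_pos (hpd _) (hreg x)).ne').congr_deriv ?_
  change _ / (2 * mnorm (G (γ x t)) (deriv (fun y => γ y t) x)) = _
  rw [div_eq_iff (by positivity)]
  have hcT := deriv_eq_mnorm_smul_unitT (c := fun y => γ y t) hpd (hreg x)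
  beta_reduce at hcT h2
  rw [← hflow] at h2
  rw [minner_comm hsym _ (deriv (γ x) t)] at h1
  rw [minner_comm hsym' (unitT _ _ _)] at h1
  rw [minner_comm hsym (deriv (fun y => deriv (γ y) t) x)]
  generalize mnorm (G (γ x t)) (deriv (fun y => γ y t) x) = v at *
  rw [show minner (G (γ x t)) (deriv (fun y => γ y t) x) (deriv (fun y => deriv (γ y) t) x) =
    v * minner (G (γ x t)) (unitT G (fun y => γ y t) x) (deriv (fun y => deriv (γ y) t) x) by
      conv_lhs => rw [hcT, minner_smul_left],
    show minner (metricDeriv G (γ x t) (deriv (γ x) t)) (deriv (fun y => γ y t) x)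
      (deriv (fun y => γ y t) x) = v * (v * minner (metricDeriv G (γ x t) (deriv (γ x) t))
        (unitT G (fun y => γ y t) x) (unitT G (fun y => γ y t) x)) by
      conv_lhs => rw [hcT, minner_smul_left, minner_smul_right]]
  linear_combination (2 * v) * h1 + (2 * v) * h2

end Flow

section WarpedProduct

variable {n : ℕ} {g : (Fin n → ℝ) → Matrix (Fin n) (Fin n) ℝ} {ψ : (Fin n → ℝ) → ℝ}

lemma minner_gwL (p u w : Fin (n + 1) → ℝ) :
    minner (gwL g ψ p) u w = ψ (fun i => p i.succ) ^ 2 * u 0 * w 0 +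
      minner (g fun i => p i.succ) (fun i => u i.succ) (fun i => w i.succ) := by
  simp only [minner, Fin.sum_univ_succ, gwL, Matrix.of_apply, Fin.cases_zero, Fin.cases_succ,
    mul_zero, zero_mul, Finset.sum_const_zero, add_zero, zero_add]
  ring

lemma minner_gwL_er (p u : Fin (n + 1) → ℝ) :
    minner (gwL g ψ p) u (er n) = ψ (fun i => p i.succ) ^ 2 * u 0 := by
  rw [minner_gwL]
  simp [er, minner]

lemma posDef_gwL (hgpd : ∀ x, (g x).PosDef) (hψpos : ∀ x, 0 < ψ x) (p : Fin (n + 1) → ℝ) :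
    (gwL g ψ p).PosDef := by
  refine Matrix.PosDef.of_dotProduct_mulVec_pos ?_ fun u hu => ?_
  · ext a b
    refine Fin.cases ?_ (fun i => ?_) a <;> refine Fin.cases ?_ (fun j => ?_) b <;>
      simp [gwL]
    exact symm_of_posDef (hgpd _) _ _
  · have h : star u ⬝ᵥ (gwL g ψ p).mulVec u = minner (gwL g ψ p) u u := by
      simp [minner_eq_dotProduct]
    rw [h, minner_gwL]
    have hψ := hψpos fun i => p i.succ
    by_cases h0 : u 0 = 0
    · have ht : (fun i : Fin n => u i.succ) ≠ 0 := fun ht =>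
        hu (funext fun a => Fin.cases h0 (fun i => congrFun ht i) a)
      simpa [h0] using minner_pos (hgpd _) ht
    · have h1 := minner_self_nonneg (hgpd fun i => p i.succ) fun i => u i.succ
      have h2 : 0 < ψ (fun i => p i.succ) ^ 2 * u 0 * u 0 := by
        rw [mul_assoc]
        exact mul_pos (by positivity) (mul_self_pos.2 h0)
      linarith

lemma differentiable_gwL (hg : ∀ i j, Differentiable ℝ fun x => g x i j)
    (hψ : Differentiable ℝ ψ) (a b : Fin (n + 1)) : Differentiable ℝ fun p => gwL g ψ p a b := by
  have ht : Differentiable ℝ fun (p : Fin (n + 1) → ℝ) (i : Fin n) => p i.succ := by fun_prop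
  refine Fin.cases ?_ (fun i => ?_) a <;> refine Fin.cases ?_ (fun j => ?_) b <;>
    simp only [gwL, Matrix.of_apply, Fin.cases_zero, Fin.cases_succ]
  · exact (hψ.comp ht).pow 2
  · exact differentiable_const _
  · exact differentiable_const _
  · exact (hg i j).comp ht

/-- The coefficients of `G_L` do not depend on `r`. -/
lemma metricDeriv_gwL_er (hg : ∀ i j, Differentiable ℝ fun x => g x i j)
    (hψ : Differentiable ℝ ψ) (p : Fin (n + 1) → ℝ) : metricDeriv (gwL g ψ) p (er n) = 0 := by
  ext a b
  have hc : HasDerivAt (fun s : ℝ => p + s • er n) (er n) 0 := by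
    simpa using ((hasDerivAt_id (0 : ℝ)).smul_const (er n)).const_add p
  have h := hasDerivAt_metric_comp (differentiable_gwL hg hψ) hc a b
  have hconst : (fun s : ℝ => gwL g ψ (p + s • er n) a b) = fun _ => gwL g ψ p a b := by
    funext s
    simp [gwL, er]
  rw [hconst] at h
  simpa using h.unique (hasDerivAt_const _ _)

lemma minner_gwL_DlogPsi (hgpd : ∀ x, (g x).PosDef) (hψ : Differentiable ℝ ψ)
    (hψpos : ∀ x, 0 < ψ x) (p V : Fin (n + 1) → ℝ) :
    minner (gwL g ψ p) V (DlogPsi g ψ fun i => p i.succ) =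
      fderiv ℝ ψ (fun i => p i.succ) (fun i => V i.succ) / ψ (fun i => p i.succ) := by
  set y : Fin n → ℝ := fun i => p i.succ
  set f : Fin n → ℝ := fun k => fderiv ℝ (fun y => Real.log (ψ y)) y (Pi.single k 1)
  have hD : (fun i : Fin n => DlogPsi g ψ y i.succ) = (g y)⁻¹.mulVec f := by
    ext i
    simp [DlogPsi, Matrix.mulVec, dotProduct, f]
  have hlog : fderiv ℝ (fun y => Real.log (ψ y)) y = (ψ y)⁻¹ • fderiv ℝ ψ y :=
    fderiv.log (hψ y) (hψpos y).ne'
  have hdet : IsUnit (g y).det := (Matrix.isUnit_iff_isUnit_det _).1 (hgpd y).isUnit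
  rw [minner_gwL, hD, minner_eq_dotProduct, Matrix.mulVec_mulVec, Matrix.mul_nonsing_inv _ hdet,
    Matrix.one_mulVec]
  conv_rhs => rw [pi_eq_sum_univ' fun i : Fin n => V i.succ]
  simp only [DlogPsi, Fin.cases_zero, mul_zero, zero_add, dotProduct, f, hlog, map_sum, map_smul,
    smul_eq_mul, _root_.smul_apply, Finset.sum_div]
  exact Finset.sum_congr rfl fun i _ => by ring

lemma normSqDlogPsi_eq_minner (hgpd : ∀ x, (g x).PosDef) (p : Fin (n + 1) → ℝ) :
    normSqDlogPsi g ψ (fun i => p i.succ) = minner (gwL g ψ p)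
      (DlogPsi g ψ fun i => p i.succ) (DlogPsi g ψ fun i => p i.succ) := by
  set y : Fin n → ℝ := fun i => p i.succ
  set f : Fin n → ℝ := fun k => fderiv ℝ (fun y => Real.log (ψ y)) y (Pi.single k 1)
  have hD : (fun i : Fin n => DlogPsi g ψ y i.succ) = (g y)⁻¹.mulVec f := by
    ext i
    simp [DlogPsi, Matrix.mulVec, dotProduct, f]
  have hdet : IsUnit (g y).det := (Matrix.isUnit_iff_isUnit_det _).1 (hgpd y).isUnit
  rw [minner_gwL, hD, minner_eq_dotProduct, Matrix.mulVec_mulVec, Matrix.mul_nonsing_inv _ hdet,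
    Matrix.one_mulVec]
  simp only [DlogPsi, Fin.cases_zero, mul_zero, zero_add, dotProduct, Matrix.mulVec,
    normSqDlogPsi, Finset.sum_mul, f]
  refine Finset.sum_congr rfl fun k _ => Finset.sum_congr rfl fun l _ => ?_
  ring_nf

end WarpedProduct

/-- If `Θ_L ≥ 0` at a point, then
`∂_t Θ_L ≥ ΔΘ_L − |D(log ψ)|² Θ_L − 2 T(Θ_L)⟨T, D(log ψ)⟩`. -/
theorem stmt8 {n : ℕ} (hn : 1 ≤ n)
    (g : (Fin n → ℝ) → Matrix (Fin n) (Fin n) ℝ)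
    (hg : ∀ i j, ContDiff ℝ (⊤ : ℕ∞) fun x => g x i j)
    (hgpd : ∀ x, (g x).PosDef)
    (ψ : (Fin n → ℝ) → ℝ) (hψ : ContDiff ℝ (⊤ : ℕ∞) ψ) (hψpos : ∀ x, 0 < ψ x)
    (t₀ : ℝ) (γ : ℝ → ℝ → Fin (n + 1) → ℝ)
    (hγ : ContDiff ℝ (⊤ : ℕ∞) fun q : ℝ × ℝ => γ q.1 q.2)
    (hreg : ∀ x t, deriv (fun y => γ y t) x ≠ 0)
    (hflow : ∀ x : ℝ, ∀ t ∈ Set.Ico (0 : ℝ) t₀,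
      deriv (γ x) t = meanCurv (gwL g ψ) (fun y => γ y t) x)
    (x : ℝ) (t : ℝ) (ht : t ∈ Set.Ico (0 : ℝ) t₀)
    (hΘ : 0 ≤ thetaL g ψ γ x t) :
    deriv (fun s => thetaL g ψ γ x s) t
      ≥ lapScal (gwL g ψ) (fun y => γ y t) (fun y => thetaL g ψ γ y t) x
        - normSqDlogPsi g ψ (fun i => γ x t i.succ) * thetaL g ψ γ x t
        - 2 * Tscal (gwL g ψ) (fun y => γ y t) (fun y => thetaL g ψ γ y t) x
            * minner (gwL g ψ (γ x t)) (unitT (gwL g ψ) (fun y => γ y t) x)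
                (DlogPsi g ψ (fun i => γ x t i.succ)) := by
  have hg' : ∀ i j, Differentiable ℝ fun x => g x i j := fun i j =>
    (hg i j).differentiable (by simp)
  have hψ' : Differentiable ℝ ψ := hψ.differentiable (by simp)
  have hG := differentiable_gwL hg' hψ'
  have hpd := posDef_gwL hgpd hψpos
  have hflow' := fun y => hflow y t ht
  have hreg' := fun y => hreg y t
  have hc := contDiff_slice hγ t
  have hcx : HasDerivAt (fun y => γ y t) (deriv (fun y => γ y t) x) x :=
    (hc.differentiable (by simp) x).hasDerivAt
  have hγt : HasDerivAt (γ x) (deriv (γ x) t) t :=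
    ((hγ.comp (contDiff_const.prodMk contDiff_id) :
      ContDiff ℝ (⊤ : ℕ∞) fun s => γ x s).differentiable (by simp) t).hasDerivAt
  have hH := (differentiable_timeDeriv hγ t x).hasDerivAt
  have hψcomp {c : ℝ → Fin (n + 1) → ℝ} {c' : Fin (n + 1) → ℝ} {s : ℝ} (h : HasDerivAt c c' s) :
      HasDerivAt (fun s => ψ fun i => c s i.succ)
        (fderiv ℝ ψ (fun i => c s i.succ) fun i => c' i.succ) s :=
    (hψ' _).hasFDerivAt.comp_hasDerivAt s
      (hasDerivAt_pi.2 fun i : Fin n => hasDerivAt_pi.1 h i.succ)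
  -- `T(Θ) = ψ² H⁰`, as `∂r` is a Killing field
  have hTΘ (y : ℝ) : Tscal (gwL g ψ) (fun y => γ y t) (fun y => thetaL g ψ γ y t) y =
      ψ (fun i => γ y t i.succ) ^ 2 * deriv (γ y) t 0 := by
    have hT := differentiable_unitT hG hpd hc hreg' y
    have h := mnorm_mul_minner_meanCurv hpd (hreg' y) hT (er n)
    have hsym := symm_of_posDef (hpd (γ y t))
    have hcy : HasDerivAt (fun y => γ y t) (deriv (fun y => γ y t) y) y :=
      (hc.differentiable (by simp) y).hasDerivAt
    have hΘ' : HasDerivAt (fun y => thetaL g ψ γ y t) _ y :=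
      hasDerivAt_minner (hasDerivAt_metric_comp hG hcy) hT.hasDerivAt (hasDerivAt_const y (er n))
    have hv := mnorm_pos (hpd (γ y t)) (hreg' y)
    rw [metricDeriv_gwL_er hg' hψ', ← hflow', minner_comm hsym, minner_gwL_er,
      minner_comm hsym (er n),
      minner_comm (metricDeriv_comm (fun p => symm_of_posDef (hpd p)) _ _) (er n)] at h
    rw [Tscal, hΘ'.deriv, inv_mul_eq_iff_eq_mul₀ hv.ne', h]
    simp [minner_eq_dotProduct, add_comm]
  have hlap : lapScal (gwL g ψ) (fun y => γ y t) (fun y => thetaL g ψ γ y t) x =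
      (mnorm (gwL g ψ (γ x t)) (deriv (fun y => γ y t) x))⁻¹ *
        (2 * ψ (fun i => γ x t i.succ) * fderiv ℝ ψ (fun i => γ x t i.succ)
            (fun i => deriv (fun y => γ y t) x i.succ) * deriv (γ x) t 0
          + ψ (fun i => γ x t i.succ) ^ 2 * deriv (fun y => deriv (γ y) t) x 0) := by
    rw [lapScal, funext hTΘ, Tscal,
      (((hψcomp hcx).fun_pow 2).fun_mul (hasDerivAt_pi.1 hH 0)).deriv]
    simp
  have hv := mnorm_pos (hpd (γ x t)) (hreg' x)
  have hΘt : HasDerivAt (fun s => thetaL g ψ γ x s)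
      (2 * ψ (fun i => γ x t i.succ) * fderiv ℝ ψ (fun i => γ x t i.succ)
          (fun i => deriv (γ x) t i.succ) * ((mnorm (gwL g ψ (γ x t))
            (deriv (fun y => γ y t) x))⁻¹ * deriv (fun y => γ y t) x 0)
        + ψ (fun i => γ x t i.succ) ^ 2 * ((mnorm (gwL g ψ (γ x t)) (deriv (fun y => γ y t) x))⁻¹ *
          (minner (gwL g ψ (γ x t)) (deriv (γ x) t) (deriv (γ x) t) * deriv (fun y => γ y t) x 0
            + deriv (fun y => deriv (γ y) t) x 0))) t := by
    simp only [thetaL, minner_gwL_er, unitT, Pi.smul_apply, smul_eq_mul]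
    refine (((hψcomp hγt).fun_pow 2).fun_mul (((hasDerivAt_mnorm_flow hG hpd hγ hreg' hflow'
      x).fun_inv hv.ne').fun_mul (hasDerivAt_pi.1 (hasDerivAt_deriv_swap hγ x t) 0))).congr_deriv ?_
    field_simp
    ring
  have hsq := minner_self_nonneg (hpd (γ x t))
    (deriv (γ x) t + DlogPsi g ψ fun i => γ x t i.succ)
  have hsym := symm_of_posDef (hpd (γ x t))
  rw [minner_add_left, minner_add_right, minner_add_right,
    minner_comm hsym (DlogPsi g ψ _) (deriv (γ x) t), minner_gwL_DlogPsi hgpd hψ' hψpos,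
    ← normSqDlogPsi_eq_minner hgpd] at hsq
  have hprod := mul_nonneg hsq hΘ
  have hψx := hψpos fun i => γ x t i.succ
  rw [hΘt.deriv, hlap, hTΘ, minner_gwL_DlogPsi hgpd hψ' hψpos]
  have hdT : fderiv ℝ ψ (fun i => γ x t i.succ)
      (fun i => unitT (gwL g ψ) (fun y => γ y t) x i.succ) =
      (mnorm (gwL g ψ (γ x t)) (deriv (fun y => γ y t) x))⁻¹ * fderiv ℝ ψ (fun i => γ x t i.succ)
        (fun i => deriv (fun y => γ y t) x i.succ) := by
    rw [← smul_eq_mul, ← map_smul]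
    rfl
  rw [hdT]
  simp only [thetaL, minner_gwL_er, unitT, Pi.smul_apply, smul_eq_mul] at hprod ⊢
  rw [ge_iff_le, ← sub_nonneg]
  refine hprod.trans_eq ?_
  field_simp
  ring

end
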